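/- For all constants a, b > 0 there exist a constant c > 0 and a threshold n₀ such that for all n ≥ n₀: every nondeterministic circuit with n actual inputs of size at most n^a and width at most b·log₂ n can be converted to a deterministic circuit computing the same Boolean function of size at most 2^{c·(log₂ n)²} and width at most c·log₂ n. -/

import Mathlib

/-!
Common definitions: Boolean circuits (with AND/OR/NOT gates of fan-in ≤ 2 and
dummy COPY gates used only for layering), nondeterministic circuits with guess
inputs, width via layerings, nondeterministic branching programs, and
U₂-circuits with their deterministic/nondeterministic circuit complexities.
-/

/-- A node of a circuit with `n` actual inputs and `m` guess inputs.
Gate nodes refer to their predecessors by (strictly smaller) indices. -/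
inductive CNode (n m : ℕ) : Type where
  | actual : Fin n → CNode n m
  | guess  : Fin m → CNode n m
  | const  : Bool → CNode n m
  | gand   : ℕ → ℕ → CNode n m
  | gor    : ℕ → ℕ → CNode n m
  | gnot   : ℕ → CNode n m
  | gcopy  : ℕ → CNode n m
deriving DecidableEq

namespace CNode

/-- The predecessor indices of a node. -/
def preds {n m : ℕ} : CNode n m → List ℕ
  | gand j k => [j, k]
  | gor j k  => [j, k]
  | gnot j   => [j]
  | gcopy j  => [j]
  | _        => []

/-- Real gates (AND, OR, NOT); these are the gates counted in the size.
COPY gates are dummy gates inserted only to make the circuit layered. -/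
def isGate {n m : ℕ} : CNode n m → Bool
  | gand _ _ => true
  | gor _ _  => true
  | gnot _   => true
  | _        => false

/-- Nodes occupying space in a layer (real gates and COPY gates);
these are counted in the width of a layer. -/
def isWide {n m : ℕ} : CNode n m → Bool
  | gand _ _ => true
  | gor _ _  => true
  | gnot _   => true
  | gcopy _  => true
  | _        => false

end CNode

/-- A (nondeterministic) Boolean circuit with `n` actual inputs and `m` guess
inputs: a DAG whose in-degree-0 nodes are labeled by actual inputs, guess
inputs or constants, whose gates are AND/OR/NOT gates (plus dummy COPY gates),
with a designated output node.  Each guess input labels at most one node. -/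
structure Circuit (n m : ℕ) : Type where
  N : ℕ
  node : Fin N → CNode n m
  output : Fin N
  wf : ∀ i : Fin N, ∀ j ∈ (node i).preds, j < (i : ℕ)
  guessOnce : ∀ g : Fin m,
    (Finset.univ.filter (fun i : Fin N => node i = CNode.guess g)).card ≤ 1

namespace Circuit

variable {n m : ℕ}

def nodeAt (c : Circuit n m) (i : ℕ) : CNode n m :=
  if h : i < c.N then c.node ⟨i, h⟩ else CNode.const false

/-- The Boolean value computed at node `i` on actual inputs `x` and
guess inputs `y`. -/
def evalAux (c : Circuit n m) (x : Fin n → Bool) (y : Fin m → Bool) : ℕ → Bool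
  | i =>
    match c.nodeAt i with
    | CNode.actual a => x a
    | CNode.guess g => y g
    | CNode.const b => b
    | CNode.gand j k =>
        (if _h : j < i then c.evalAux x y j else false) &&
        (if _h : k < i then c.evalAux x y k else false)
    | CNode.gor j k =>
        (if _h : j < i then c.evalAux x y j else false) ||
        (if _h : k < i then c.evalAux x y k else false)
    | CNode.gnot j => !(if _h : j < i then c.evalAux x y j else false)
    | CNode.gcopy j => (if _h : j < i then c.evalAux x y j else false)
termination_by i => i

/-- The output value of the circuit. -/
def eval (c : Circuit n m) (x : Fin n → Bool) (y : Fin m → Bool) : Bool :=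
  c.evalAux x y c.output

/-- A nondeterministic circuit computes `f` if for every actual input `x`,
`f x = 1` iff some assignment of the guess inputs makes the circuit output 1.
(For `m = 0` this is the usual notion for deterministic circuits.) -/
def Computes (c : Circuit n m) (f : (Fin n → Bool) → Bool) : Prop :=
  ∀ x : Fin n → Bool, f x = true ↔ ∃ y : Fin m → Bool, c.eval x y = true

/-- The size of a circuit: the number of (non-COPY) gates. -/
def size (c : Circuit n m) : ℕ :=
  (Finset.univ.filter (fun i : Fin c.N => (c.node i).isGate = true)).card

/-- `ℓ` is a layering of the circuit: every wire goes between adjacent layers. -/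
def IsLayering (c : Circuit n m) (ℓ : Fin c.N → ℕ) : Prop :=
  ∀ i : Fin c.N, ∀ j ∈ (c.node i).preds, ∀ hj : j < c.N, ℓ ⟨j, hj⟩ + 1 = ℓ i

/-- The circuit has width at most `w`: there is a layering in which every layer
contains at most `w` gates (real gates and COPY gates). -/
def HasWidth (c : Circuit n m) (w : ℕ) : Prop :=
  ∃ ℓ : Fin c.N → ℕ, c.IsLayering ℓ ∧
    ∀ t : ℕ,
      (Finset.univ.filter
        (fun i : Fin c.N => ℓ i = t ∧ (c.node i).isWide = true)).card ≤ w

/-- The circuit is read-`k`-times: every actual input labels at most `k` nodes. -/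
def ReadK (c : Circuit n m) (k : ℕ) : Prop :=
  ∀ a : Fin n,
    (Finset.univ.filter (fun i : Fin c.N => c.node i = CNode.actual a)).card ≤ k

/-- The maximal number of (non-COPY) gates on a path ending at node `i`. -/
def depthAux (c : Circuit n m) : ℕ → ℕ
  | i =>
    match c.nodeAt i with
    | CNode.actual _ => 0
    | CNode.guess _ => 0
    | CNode.const _ => 0
    | CNode.gand j k =>
        max (if _h : j < i then c.depthAux j else 0)
            (if _h : k < i then c.depthAux k else 0) + 1
    | CNode.gor j k =>
        max (if _h : j < i then c.depthAux j else 0)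
            (if _h : k < i then c.depthAux k else 0) + 1
    | CNode.gnot j => (if _h : j < i then c.depthAux j else 0) + 1
    | CNode.gcopy j => (if _h : j < i then c.depthAux j else 0)
termination_by i => i

/-- The depth of a circuit: the maximal number of gates on a directed path
from an input to the output. -/
def depth (c : Circuit n m) : ℕ := c.depthAux c.output

end Circuit

/-- A nondeterministic branching program on `n` Boolean variables: a DAG whose
inner nodes are labeled by variables with outgoing edges labeled 0 or 1 (edges
go to strictly larger indices), whose sinks are labeled 0 or 1, with a
designated start node. -/
structure NBP (n : ℕ) : Type where
  N : ℕ
  label : Fin N → Fin n ⊕ Bool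
  edges : Fin N → Bool → Finset (Fin N)
  start : Fin N
  wf : ∀ i : Fin N, ∀ b : Bool, ∀ j ∈ edges i b,
        (i : ℕ) < (j : ℕ) ∧ (label i).isLeft

namespace NBP

variable {n : ℕ}

/-- The size of a branching program: the number of its nodes. -/
def size (B : NBP n) : ℕ := B.N

/-- On input `x`, some path from node `i` consistent with `x` reaches a 1-sink. -/
def AccFrom (B : NBP n) (x : Fin n → Bool) : Fin B.N → Prop
  | i =>
    match B.label i with
    | Sum.inr b => b = true
    | Sum.inl v => ∃ j ∈ B.edges i (x v), ∃ _h : (i : ℕ) < (j : ℕ), B.AccFrom x j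
termination_by i => B.N - (i : ℕ)
decreasing_by
  have := j.isLt
  omega

/-- A nondeterministic branching program computes `f` if for every `x`,
`f x = 1` iff at least one path consistent with `x` leads to a 1-sink. -/
def Computes (B : NBP n) (f : (Fin n → Bool) → Bool) : Prop :=
  ∀ x : Fin n → Bool, f x = true ↔ B.AccFrom x B.start

/-- A (syntactic) path in the underlying graph of the branching program. -/
def IsPath (B : NBP n) : List (Fin B.N) → Prop
  | [] => True
  | [_] => True
  | i :: j :: p => (∃ b : Bool, j ∈ B.edges i b) ∧ B.IsPath (j :: p)

/-- The branching program is syntactic read-`k`-times: every variable appears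
at most `k` times on each path. -/
def SyntacticReadK (B : NBP n) (k : ℕ) : Prop :=
  ∀ p : List (Fin B.N), B.IsPath p → ∀ v : Fin n,
    (p.countP fun i => decide (B.label i = Sum.inl v)) ≤ k

end NBP

/-- A node of a `U₂`-circuit.  A gate `gate a b c j k` computes
`((vⱼ ⊕ a) ∧ (v_k ⊕ b)) ⊕ c` from the values `vⱼ, v_k` of its two
predecessors; these are exactly the Boolean functions in `U₂`
(all two-variable Boolean functions except XOR and its complement). -/
inductive U2Node (n m : ℕ) : Type where
  | actual : Fin n → U2Node n m
  | guess  : Fin m → U2Node n m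
  | const  : Bool → U2Node n m
  | gate   : Bool → Bool → Bool → ℕ → ℕ → U2Node n m
deriving DecidableEq

namespace U2Node

def isGate {n m : ℕ} : U2Node n m → Bool
  | gate _ _ _ _ _ => true
  | _ => false

end U2Node

/-- A (nondeterministic) `U₂`-circuit with `n` actual inputs and `m` guess
inputs: every gate has fan-in 2 and is labeled by a function in `U₂`. -/
structure U2Circuit (n m : ℕ) : Type where
  N : ℕ
  node : Fin N → U2Node n m
  output : Fin N
  wf : ∀ i : Fin N, ∀ a b c j k,
        node i = U2Node.gate a b c j k → j < (i : ℕ) ∧ k < (i : ℕ)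

namespace U2Circuit

variable {n m : ℕ}

def nodeAt (c : U2Circuit n m) (i : ℕ) : U2Node n m :=
  if h : i < c.N then c.node ⟨i, h⟩ else U2Node.const false

def evalAux (c : U2Circuit n m) (x : Fin n → Bool) (y : Fin m → Bool) : ℕ → Bool
  | i =>
    match c.nodeAt i with
    | U2Node.actual a => x a
    | U2Node.guess g => y g
    | U2Node.const b => b
    | U2Node.gate a b cc j k =>
        xor
          ((xor (if _h : j < i then c.evalAux x y j else false) a) &&
           (xor (if _h : k < i then c.evalAux x y k else false) b))
          cc
termination_by i => i

def eval (c : U2Circuit n m) (x : Fin n → Bool) (y : Fin m → Bool) : Bool :=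
  c.evalAux x y c.output

/-- A nondeterministic `U₂`-circuit computes `f` if for every actual input `x`,
`f x = 1` iff some assignment of the guess inputs makes the circuit output 1. -/
def Computes (c : U2Circuit n m) (f : (Fin n → Bool) → Bool) : Prop :=
  ∀ x : Fin n → Bool, f x = true ↔ ∃ y : Fin m → Bool, c.eval x y = true

/-- The size of a `U₂`-circuit: the number of its gates. -/
def size (c : U2Circuit n m) : ℕ :=
  (Finset.univ.filter (fun i : Fin c.N => (c.node i).isGate = true)).card

end U2Circuit

/-- `size^dc f`: the size of the smallest deterministic `U₂`-circuit
computing `f`. -/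
noncomputable def sizeDC {n : ℕ} (f : (Fin n → Bool) → Bool) : ℕ :=
  sInf {s : ℕ | ∃ c : U2Circuit n 0, c.Computes f ∧ c.size = s}

/-- `size^ndc f`: the size of the smallest nondeterministic `U₂`-circuit
computing `f`. -/
noncomputable def sizeNDC {n : ℕ} (f : (Fin n → Bool) → Bool) : ℕ :=
  sInf {s : ℕ | ∃ m : ℕ, ∃ c : U2Circuit n m, c.Computes f ∧ c.size = s}

/-- The parity function: `parityFun n x = 1` iff `Σ xᵢ ≡ 1 (mod 2)`. -/
def parityFun (n : ℕ) : (Fin n → Bool) → Bool :=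
  fun x => decide ((∑ i : Fin n, (x i).toNat) % 2 = 1)

theorem blockIdx_lt {m : ℕ} (i j : Fin m) : m * (i : ℕ) + (j : ℕ) < m * m := by
  have hi := i.isLt
  have hj := j.isLt
  nlinarith

/-- The disjunction of the parities of the `m` consecutive blocks of `m`
variables:
`⋁_{i=0}^{m-1} Parity_m (x_{m·i+1}, …, x_{m·i+m})` on `n = m²` variables. -/
def blockParityOr (m : ℕ) : (Fin (m * m) → Bool) → Bool :=
  fun x => decide (∃ i : Fin m,
    parityFun m (fun j => x ⟨m * (i : ℕ) + (j : ℕ), blockIdx_lt i j⟩) = true)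

/-! ### Evaluation of circuits -/

/-- The value of a node, given the values `σ` of its predecessors. -/
def CNode.value {n m : ℕ} (x : Fin n → Bool) (y : Fin m → Bool) (σ : ℕ → Bool) :
    CNode n m → Bool
  | .actual a => x a
  | .guess g => y g
  | .const b => b
  | .gand j k => σ j && σ k
  | .gor j k => σ j || σ k
  | .gnot j => !σ j
  | .gcopy j => σ j

theorem CNode.value_congr {n m : ℕ} {x : Fin n → Bool} {y : Fin m → Bool} {σ τ : ℕ → Bool}
    {v : CNode n m} (h : ∀ j ∈ v.preds, σ j = τ j) : v.value x y σ = v.value x y τ := by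
  cases v <;> simp_all [CNode.value, CNode.preds]

theorem CNode.value_of_isWide {n m : ℕ} {x x' : Fin n → Bool} {y y' : Fin m → Bool}
    {σ : ℕ → Bool} {v : CNode n m} (h : v.isWide = true) :
    v.value x y σ = v.value x' y' σ := by
  cases v <;> simp_all [CNode.value, CNode.isWide]

theorem CNode.isWide_of_isGate {n m : ℕ} {v : CNode n m} (h : v.isGate = true) :
    v.isWide = true := by
  cases v <;> simp_all [CNode.isGate, CNode.isWide]

theorem CNode.length_preds_le {n m : ℕ} (v : CNode n m) : v.preds.length ≤ 2 := by
  cases v <;> simp [CNode.preds]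

namespace Circuit

variable {n m : ℕ}

theorem nodeAt_of_lt (c : Circuit n m) {i : ℕ} (h : i < c.N) : c.nodeAt i = c.node ⟨i, h⟩ :=
  dif_pos h

theorem preds_lt (c : Circuit n m) {i j : ℕ} (hj : j ∈ (c.nodeAt i).preds) : j < i := by
  by_cases h : i < c.N
  · rw [c.nodeAt_of_lt h] at hj
    exact c.wf ⟨i, h⟩ j hj
  · simp [nodeAt, h, CNode.preds] at hj

theorem evalAux_eq (c : Circuit n m) (x : Fin n → Bool) (y : Fin m → Bool) (i : ℕ) :
    c.evalAux x y i = (c.nodeAt i).value x y (c.evalAux x y) := by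
  have hp : ∀ j ∈ (c.nodeAt i).preds, j < i := fun j hj => c.preds_lt hj
  rw [evalAux]
  cases h : c.nodeAt i <;> simp_all [CNode.value, CNode.preds]

end Circuit

/-! ### Straight-line register programs -/

section RegisterPrograms

variable {n : ℕ}

/-- Run a straight-line program.  An instruction `(d, v)` overwrites register `d` by the value
of the node `v`, whose predecessors are read as registers. -/
def runProg (x : Fin n → Bool) (P : List (ℕ × CNode n 0)) (σ : ℕ → Bool) : ℕ → Bool :=
  P.foldl (fun τ ins => Function.update τ ins.1 (ins.2.value x Fin.elim0 τ)) σ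

theorem runProg_append (x : Fin n → Bool) (P Q : List (ℕ × CNode n 0)) (σ : ℕ → Bool) :
    runProg x (P ++ Q) σ = runProg x Q (runProg x P σ) := by
  simp [runProg]

theorem runProg_singleton (x : Fin n → Bool) (d : ℕ) (v : CNode n 0) (σ : ℕ → Bool) :
    runProg x [(d, v)] σ = Function.update σ d (v.value x Fin.elim0 σ) := rfl

/-- `g` can be evaluated by a straight-line program of length at most `S` using `R` registers
starting at any given register `r`, without disturbing the registers below `r`. -/
def RegComputable (g : (Fin n → Bool) → Prop) (R S : ℕ) : Prop :=
  ∀ r : ℕ, ∃ P : List (ℕ × CNode n 0), P.length ≤ S ∧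
    (∀ ins ∈ P, ∀ j ∈ ins.2.preds, j < r + R) ∧
    ∀ x σ, (runProg x P σ r = true ↔ g x) ∧ ∀ j < r, runProg x P σ j = σ j

namespace RegComputable

variable {g h : (Fin n → Bool) → Prop} {R S R' S' : ℕ}

theorem mono (hg : RegComputable g R S) (hR : R ≤ R') (hS : S ≤ S') :
    RegComputable g R' S' := by
  intro r
  obtain ⟨P, h1, h2, h3⟩ := hg r
  exact ⟨P, h1.trans hS, fun ins hi j hj => (h2 ins hi j hj).trans_le (by omega), h3⟩

theorem congr (hg : RegComputable g R S) (hgh : ∀ x, g x ↔ h x) : RegComputable h R S := by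
  rwa [← funext fun x => propext (hgh x)]

theorem var (a : Fin n) : RegComputable (fun x => x a = true) 1 1 := by
  intro r
  refine ⟨[(r, .actual a)], by simp, by simp [CNode.preds], fun x σ => ?_⟩
  refine ⟨by simp [runProg_singleton, CNode.value], fun j hj => ?_⟩
  simp [runProg_singleton, Function.update_of_ne hj.ne]

theorem const (p : Prop) : RegComputable (fun _ : Fin n → Bool => p) 1 1 := by
  classical
  intro r
  refine ⟨[(r, .const (decide p))], by simp, by simp [CNode.preds], fun x σ => ?_⟩
  refine ⟨by simp [runProg_singleton, CNode.value], fun j hj => ?_⟩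
  simp [runProg_singleton, Function.update_of_ne hj.ne]

theorem not (hg : RegComputable g R S) (hR : 0 < R) :
    RegComputable (fun x => ¬ g x) R (S + 1) := by
  intro r
  obtain ⟨P, h1, h2, h3⟩ := hg r
  refine ⟨P ++ [(r, .gnot r)], by simpa using h1, ?_, fun x σ => ⟨?_, fun j hj => ?_⟩⟩
  · intro ins hi j hj
    rcases List.mem_append.1 hi with hi | hi
    · exact h2 ins hi j hj
    · obtain rfl := List.mem_singleton.1 hi
      simp only [CNode.preds, List.mem_singleton] at hj
      omega
  · simp [runProg_append, runProg_singleton, ← (h3 x σ).1, CNode.value]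
  · rw [runProg_append, runProg_singleton, Function.update_of_ne hj.ne, (h3 x σ).2 j hj]

theorem binary (hg : RegComputable g R S) (hh : RegComputable h R' S') (hR : 0 < R')
    (op : ℕ → ℕ → CNode n 0) (f : Prop → Prop → Prop)
    (hpreds : ∀ j k, (op j k).preds = [j, k])
    (hop : ∀ x σ j k, (op j k).value x Fin.elim0 σ = true ↔ f (σ j = true) (σ k = true)) :
    RegComputable (fun x => f (g x) (h x)) (max R (R' + 1)) (S + S' + 1) := by
  intro r
  obtain ⟨P, h1, h2, h3⟩ := hg r
  obtain ⟨Q, k1, k2, k3⟩ := hh (r + 1)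
  refine ⟨P ++ (Q ++ [(r, op r (r + 1))]), ?_, ?_, fun x σ => ⟨?_, fun j hj => ?_⟩⟩
  · simp only [List.length_append, List.length_singleton]
    omega
  · intro ins hi j hj
    rcases List.mem_append.1 hi with hi | hi
    · have := h2 ins hi j hj
      omega
    rcases List.mem_append.1 hi with hi | hi
    · have := k2 ins hi j hj
      omega
    · obtain rfl := List.mem_singleton.1 hi
      simp only [hpreds, List.mem_cons, List.not_mem_nil, or_false] at hj
      omega
  · rw [runProg_append, runProg_append, runProg_singleton, Function.update_self, hop,
      (k3 x _).1, (k3 x _).2 r (Nat.lt_succ_self r), (h3 x σ).1]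
  · rw [runProg_append, runProg_append, runProg_singleton, Function.update_of_ne hj.ne,
      (k3 x _).2 j (by omega), (h3 x σ).2 j hj]

theorem and (hg : RegComputable g R S) (hh : RegComputable h R' S') (hR : 0 < R') :
    RegComputable (fun x => g x ∧ h x) (max R (R' + 1)) (S + S' + 1) :=
  hg.binary hh hR CNode.gand And (fun _ _ => rfl) (by simp [CNode.value])

theorem or (hg : RegComputable g R S) (hh : RegComputable h R' S') (hR : 0 < R') :
    RegComputable (fun x => g x ∨ h x) (max R (R' + 1)) (S + S' + 1) :=
  hg.binary hh hR CNode.gor Or (fun _ _ => rfl) (by simp [CNode.value])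

theorem exists_mem {ι : Type*} (T : Finset ι) {g : ι → (Fin n → Bool) → Prop} (hR : 0 < R)
    (hg : ∀ i ∈ T, RegComputable (g i) R S) :
    RegComputable (fun x => ∃ i ∈ T, g i x) (R + 1) (T.card * (S + 1) + 1) := by
  classical
  induction T using Finset.induction_on with
  | empty => exact ((const False).mono (by omega) (by simp)).congr (by simp)
  | insert i T hi ih =>
    have h1 := ih fun j hj => hg j (Finset.mem_insert_of_mem hj)
    have h2 := hg i (Finset.mem_insert_self i T)
    refine ((h1.or h2 hR).mono (by omega) ?_).congr fun x => ?_
    · rw [Finset.card_insert_of_notMem hi, Nat.add_mul]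
      omega
    · rw [Finset.exists_mem_insert, or_comm]

theorem of_dependsOn (V : List (Fin n)) (hg : ∀ x x', (∀ a ∈ V, x a = x' a) → g x → g x') :
    RegComputable g (2 * V.length + 1) (7 * 2 ^ V.length - 6) := by
  induction V generalizing g with
  | nil =>
    exact ((const (g fun _ => false)).mono (by simp) (by simp)).congr
      fun x => ⟨hg _ _ (by simp), hg _ _ (by simp)⟩
  | cons a V ih =>
    have key : ∀ b, RegComputable (fun x => g (Function.update x a b))
        (2 * V.length + 1) (7 * 2 ^ V.length - 6) := by
      refine fun b => ih fun x x' hx => hg _ _ fun c hc => ?_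
      by_cases hca : c = a
      · subst hca; simp
      · simpa [hca] using hx c ((List.mem_cons.1 hc).resolve_left hca)
    have := (((var a).and (key true) (by omega)).or
      ((((var a).not Nat.one_pos).and (key false) (by omega))) (by omega))
    refine (this.mono ?_ ?_).congr fun x => ?_
    · simp only [List.length_cons]; omega
    · simp only [List.length_cons, pow_succ]
      have := Nat.one_le_two_pow (n := V.length)
      omega
    · cases hx : x a <;> simp [← hx]

end RegComputable

/-- The `i`-th node of a circuit whose layer `t` holds the contents of the first `R` registers
after `t` steps of the program `P`. -/
def progNode (P : List (ℕ × CNode n 0)) (R i : ℕ) : CNode n 0 :=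
  match P[i / R - 1]? with
  | none => .const false
  | some ins =>
    if i / R = 0 then .const false
    else if i % R = ins.1 then
      match ins.2 with
      | .actual a => .actual a
      | .guess g => .guess g
      | .const b => .const b
      | .gand j k => .gand ((i / R - 1) * R + j) ((i / R - 1) * R + k)
      | .gor j k => .gor ((i / R - 1) * R + j) ((i / R - 1) * R + k)
      | .gnot j => .gnot ((i / R - 1) * R + j)
      | .gcopy j => .gcopy ((i / R - 1) * R + j)
    else .gcopy ((i / R - 1) * R + i % R)

theorem progNode_preds {P : List (ℕ × CNode n 0)} {R i j : ℕ} (hR : 0 < R)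
    (hP : ∀ ins ∈ P, ∀ j ∈ ins.2.preds, j < R) (hj : j ∈ (progNode P R i).preds) :
    i / R ≠ 0 ∧ j / R = i / R - 1 := by
  have hdiv : ∀ k < R, ((i / R - 1) * R + k) / R = i / R - 1 := fun k hk => by
    rw [mul_comm, Nat.mul_add_div hR, Nat.div_eq_of_lt hk, add_zero]
  unfold progNode at hj
  cases hi : P[i / R - 1]? with
  | none => simp [hi, CNode.preds] at hj
  | some ins =>
    have hins := hP ins (List.mem_of_getElem? hi)
    rw [hi] at hj
    by_cases h0 : i / R = 0
    · simp [h0, CNode.preds] at hj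
    refine ⟨h0, ?_⟩
    by_cases hd : i % R = ins.1
    · simp only [h0, hd, if_true, if_false] at hj
      obtain ⟨d, v⟩ := ins
      cases v <;> simp only [CNode.preds, List.mem_cons, List.not_mem_nil, or_false] at hj hins
      · rcases hj with rfl | rfl <;> exact hdiv _ (hins _ (by simp))
      · rcases hj with rfl | rfl <;> exact hdiv _ (hins _ (by simp))
      · subst hj; exact hdiv _ (hins _ rfl)
      · subst hj; exact hdiv _ (hins _ rfl)
    · simp only [h0, hd, if_false, CNode.preds, List.mem_singleton] at hj
      subst hj
      exact hdiv _ (Nat.mod_lt _ hR)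

theorem progNode_isGate {P : List (ℕ × CNode n 0)} {R i : ℕ}
    (h : (progNode P R i).isGate = true) :
    i / R ≠ 0 ∧ ∃ ins, P[i / R - 1]? = some ins ∧ i % R = ins.1 := by
  unfold progNode at h
  cases hi : P[i / R - 1]? with
  | none => simp [hi, CNode.isGate] at h
  | some ins =>
    rw [hi] at h
    by_cases h0 : i / R = 0
    · simp [h0, CNode.isGate] at h
    by_cases hd : i % R = ins.1
    · exact ⟨h0, ins, rfl, hd⟩
    · simp [h0, hd, CNode.isGate] at h

/-- The layered circuit simulating a straight-line program on `R` registers. -/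
def progCircuit (P : List (ℕ × CNode n 0)) (R : ℕ) (hR : 0 < R)
    (hP : ∀ ins ∈ P, ∀ j ∈ ins.2.preds, j < R) : Circuit n 0 where
  N := (P.length + 1) * R
  node i := progNode P R i
  output := ⟨P.length * R, by nlinarith⟩
  wf i j hj := by
    obtain ⟨h0, h1⟩ := progNode_preds hR hP hj
    by_contra! h
    have := Nat.div_le_div_right (c := R) h
    generalize (i : ℕ) / R = p at *
    generalize j / R = q at *
    omega
  guessOnce g := g.elim0

variable {P : List (ℕ × CNode n 0)} {R : ℕ} {hR : 0 < R}
  {hP : ∀ ins ∈ P, ∀ j ∈ ins.2.preds, j < R}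

theorem progCircuit_evalAux (x : Fin n → Bool) (y : Fin 0 → Bool) (t : ℕ) (ht : t ≤ P.length)
    (r : ℕ) (hr : r < R) :
    (progCircuit P R hR hP).evalAux x y (t * R + r) =
      runProg x (P.take t) (fun _ => false) r := by
  induction t generalizing r with
  | zero =>
    rw [Circuit.evalAux_eq, Circuit.nodeAt_of_lt _ (by change _ < (P.length + 1) * R; nlinarith)]
    change (progNode P R (0 * R + r)).value _ _ _ = _
    unfold progNode
    rw [zero_mul, zero_add, Nat.div_eq_of_lt hr]
    cases h : P[0 - 1]? <;> simp [CNode.value, runProg]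
  | succ t ih =>
    have ih' := ih (by omega)
    have hdiv : ((t + 1) * R + r) / R = t + 1 := by
      rw [mul_comm, Nat.mul_add_div hR, Nat.div_eq_of_lt hr, add_zero]
    have hmod : ((t + 1) * R + r) % R = r := by
      rw [mul_comm, Nat.mul_add_mod, Nat.mod_eq_of_lt hr]
    have hins := hP _ (List.getElem_mem (l := P) (n := t) ht)
    rw [Circuit.evalAux_eq, Circuit.nodeAt_of_lt _ (by change _ < (P.length + 1) * R; nlinarith),
      List.take_succ_eq_append_getElem ht, runProg_append]
    change (progNode P R ((t + 1) * R + r)).value _ _ _ = _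
    unfold progNode
    rw [hdiv, hmod, Nat.add_sub_cancel, List.getElem?_eq_getElem ht]
    generalize P[t] = ins at hins ⊢
    obtain ⟨d, v⟩ := ins
    simp only [runProg_singleton, Nat.add_one_ne_zero, if_false] at hins ⊢
    by_cases hd : r = d
    · subst hd
      cases v with
      | guess g => exact g.elim0
      | _ => simp_all [CNode.value, CNode.preds]
    · simp [hd, CNode.value, ih' r hr]

theorem progCircuit_size_le : (progCircuit P R hR hP).size ≤ P.length := by
  unfold Circuit.size
  conv_rhs => rw [← Finset.card_range P.length]
  refine Finset.card_le_card_of_injOn (fun i => (i : ℕ) / R - 1) ?_ ?_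
  · intro i hi
    obtain ⟨h0, ins, h1, -⟩ := progNode_isGate (Finset.mem_filter.1 hi).2
    simpa using (List.getElem?_eq_some_iff.1 h1).1
  · intro i hi j hj hij
    obtain ⟨hi0, ins, hi1, hi2⟩ := progNode_isGate (Finset.mem_filter.1 hi).2
    obtain ⟨hj0, ins', hj1, hj2⟩ := progNode_isGate (Finset.mem_filter.1 hj).2
    simp only at hij
    rw [hij, hj1] at hi1
    cases hi1
    have hd : (i : ℕ) / R = (j : ℕ) / R := by
      generalize (i : ℕ) / R = p at *
      generalize (j : ℕ) / R = q at *
      omega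
    apply Fin.ext
    rw [← Nat.div_add_mod (i : ℕ) R, ← Nat.div_add_mod (j : ℕ) R, hd, hi2, hj2]

theorem progCircuit_hasWidth : (progCircuit P R hR hP).HasWidth R := by
  refine ⟨fun i => (i : ℕ) / R, fun i j hj hjN => ?_, fun t => ?_⟩
  · obtain ⟨h0, h1⟩ := progNode_preds hR hP hj
    change j / R + 1 = (i : ℕ) / R
    rw [h1, Nat.sub_add_cancel (Nat.one_le_iff_ne_zero.2 h0)]
  · conv_rhs => rw [← Finset.card_range R]
    refine Finset.card_le_card_of_injOn (fun i => (i : ℕ) % R) ?_ ?_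
    · intro i _
      simpa using Nat.mod_lt _ hR
    · intro i hi j hj hij
      have hi := (Finset.mem_filter.1 hi).2.1
      have hj := (Finset.mem_filter.1 hj).2.1
      simp only at hij hi hj
      apply Fin.ext
      rw [← Nat.div_add_mod (i : ℕ) R, ← Nat.div_add_mod (j : ℕ) R, hi, hj, hij]

end RegisterPrograms

theorem RegComputable.exists_circuit {n R S : ℕ} {f : (Fin n → Bool) → Bool} (hR : 0 < R)
    (h : RegComputable (fun x => f x = true) R S) :
    ∃ D : Circuit n 0, D.Computes f ∧ D.size ≤ S ∧ D.HasWidth R := by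
  obtain ⟨P, h1, h2, h3⟩ := h 0
  rw [zero_add] at h2
  refine ⟨progCircuit P R hR h2, fun x => ?_, progCircuit_size_le.trans h1,
    progCircuit_hasWidth⟩
  have key : ∀ y, (progCircuit P R hR h2).eval x y = runProg x P (fun _ => false) 0 := fun y => by
    have := progCircuit_evalAux (hR := hR) (hP := h2) x y P.length le_rfl 0 hR
    rwa [add_zero, List.take_length] at this
  simp only [key, exists_const, (h3 x _).1]

/-! ### Constraint systems with small balanced separators -/

/-- Every splitting of the list `L` into a prefix and a suffix has all variables shared by the
scopes of both parts contained in a set of at most `W` variables. -/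
def HasSeparators (scope : ℕ → Finset ℕ) (W : ℕ) (L : List ℕ) : Prop :=
  ∀ A B : List ℕ, L = A ++ B →
    ∃ T : Finset ℕ, T.card ≤ W ∧ ∀ i ∈ A, ∀ j ∈ B, scope i ∩ scope j ⊆ T

theorem HasSeparators.left {scope : ℕ → Finset ℕ} {W : ℕ} {A B : List ℕ}
    (h : HasSeparators scope W (A ++ B)) : HasSeparators scope W A := by
  rintro A₁ A₂ rfl
  obtain ⟨T, hT, hs⟩ := h A₁ (A₂ ++ B) (by simp)
  exact ⟨T, hT, fun i hi j hj => hs i hi j (by simp [hj])⟩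

theorem HasSeparators.right {scope : ℕ → Finset ℕ} {W : ℕ} {A B : List ℕ}
    (h : HasSeparators scope W (A ++ B)) : HasSeparators scope W B := by
  rintro B₁ B₂ rfl
  obtain ⟨T, hT, hs⟩ := h (A ++ B₁) B₂ (by simp)
  exact ⟨T, hT, fun i hi j hj => hs i (by simp [hi]) j hj⟩

/-- A pinned constraint system splits along a separator: guess the values on the separator. -/
theorem exists_solution_append_iff {scope : ℕ → Finset ℕ} {P : ℕ → (ℕ → Bool) → Prop}
    (hP : ∀ i z z', (∀ v ∈ scope i, z v = z' v) → P i z → P i z') {A B : List ℕ}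
    {T : Finset ℕ} (hT : ∀ i ∈ A, ∀ j ∈ B, scope i ∩ scope j ⊆ T) (V : Finset ℕ) (u : ℕ → Bool) :
    (∃ z : ℕ → Bool, (∀ v ∈ V, z v = u v) ∧ ∀ i ∈ A ++ B, P i z) ↔
      ∃ e ∈ T.powerset,
        (∃ z : ℕ → Bool, (∀ v ∈ V ∪ T, z v = if v ∈ V then u v else decide (v ∈ e)) ∧
          ∀ i ∈ A, P i z) ∧
        ∃ z : ℕ → Bool, (∀ v ∈ V ∪ T, z v = if v ∈ V then u v else decide (v ∈ e)) ∧
          ∀ i ∈ B, P i z := by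
  classical
  constructor
  · rintro ⟨z, hz, hs⟩
    have hz' : ∀ v ∈ V ∪ T, z v =
        if v ∈ V then u v else decide (v ∈ T.filter fun v => z v = true) := by
      intro v hv
      by_cases hvV : v ∈ V
      · simp [hvV, hz v hvV]
      · have := (Finset.mem_union.1 hv).resolve_left hvV
        simp [hvV, this]
    exact ⟨_, Finset.mem_powerset.2 (Finset.filter_subset _ _),
      ⟨z, hz', fun i hi => hs i (by simp [hi])⟩, ⟨z, hz', fun i hi => hs i (by simp [hi])⟩⟩
  · rintro ⟨e, -, ⟨z₁, h₁, s₁⟩, ⟨z₂, h₂, s₂⟩⟩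
    refine ⟨fun v => if ∃ i ∈ A, v ∈ scope i then z₁ v else z₂ v, fun v hv => ?_, fun i hi => ?_⟩
    · have e₁ := h₁ v (Finset.mem_union_left _ hv)
      have e₂ := h₂ v (Finset.mem_union_left _ hv)
      simp only [hv, if_true] at e₁ e₂
      simp [e₁, e₂]
    · rcases List.mem_append.1 hi with hi | hi
      · refine hP i z₁ _ (fun v hv => ?_) (s₁ i hi)
        rw [if_pos ⟨i, hi, hv⟩]
      · refine hP i z₂ _ (fun v hv => ?_) (s₂ i hi)
        split_ifs with h
        · obtain ⟨j, hj, hjv⟩ := h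
          have hvT := hT j hj i hi (Finset.mem_inter.2 ⟨hjv, hv⟩)
          rw [h₁ v (Finset.mem_union_right _ hvT), h₂ v (Finset.mem_union_right _ hvT)]
        · rfl

/-- Savitch-style divide and conquer: the solvability of a constraint system with small
separators is computable with few registers. -/
theorem regComputable_solvable {n W : ℕ} {scope : ℕ → Finset ℕ}
    {P : ℕ → (Fin n → Bool) → (ℕ → Bool) → Prop}
    (hP : ∀ i x z z', (∀ v ∈ scope i, z v = z' v) → P i x z → P i x z')
    (hdep : ∀ i, ∃ V : List (Fin n), V.length ≤ 2 ∧
      ∀ x x' z, (∀ a ∈ V, x a = x' a) → P i x z → P i x' z)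
    (k : ℕ) (L : List ℕ) (hL : L.length ≤ 2 ^ k) (hsep : HasSeparators scope W L)
    (V : Finset ℕ) (u : ℕ → Bool) :
    RegComputable (fun x => ∃ z : ℕ → Bool, (∀ v ∈ V, z v = u v) ∧ ∀ i ∈ L, P i x z)
      (5 + 2 * k) (22 * 2 ^ ((W + 3) * k)) := by
  induction k generalizing L V u with
  | zero =>
    have : ∃ D : List (Fin n), D.length ≤ 2 ∧
        ∀ x x', (∀ a ∈ D, x a = x' a) → ∀ z, (∀ i ∈ L, P i x z) → ∀ i ∈ L, P i x' z := by
      match L, hL with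
      | [], _ => exact ⟨[], by simp, by simp⟩
      | [i], _ =>
        obtain ⟨D, hD, h⟩ := hdep i
        exact ⟨D, hD, fun x x' hx z => by simpa using h x x' z hx⟩
    obtain ⟨D, hD, h⟩ := this
    refine (RegComputable.of_dependsOn D ?_).mono (by omega) ?_
    · rintro x x' hx ⟨z, hz, hs⟩
      exact ⟨z, hz, h x x' hx z hs⟩
    · have := Nat.pow_le_pow_right two_pos hD
      rw [mul_zero, pow_zero]
      omega
  | succ k ih =>
    obtain ⟨A, B, rfl, hA, hB⟩ :
        ∃ A B, L = A ++ B ∧ A.length ≤ 2 ^ k ∧ B.length ≤ 2 ^ k := by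
      refine ⟨L.take (2 ^ k), L.drop (2 ^ k), (List.take_append_drop _ _).symm, by simp, ?_⟩
      rw [List.length_drop]
      rw [pow_succ] at hL
      omega
    obtain ⟨T, hTW, hT⟩ := hsep A B rfl
    have key := RegComputable.exists_mem T.powerset (by omega)
      fun (e : Finset ℕ) _ =>
        (ih A hA hsep.left (V ∪ T) fun v => if v ∈ V then u v else decide (v ∈ e)).and
          (ih B hB hsep.right (V ∪ T) fun v => if v ∈ V then u v else decide (v ∈ e)) (by omega)
    refine (key.mono (by omega) ?_).congr fun x =>
      (exists_solution_append_iff (P := fun i z => P i x z) (fun i => hP i x) hT V u).symm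
    have h1 : T.powerset.card ≤ 2 ^ W := by
      rw [Finset.card_powerset]
      exact Nat.pow_le_pow_right two_pos hTW
    have h2 : 2 ^ ((W + 3) * (k + 1)) = 2 ^ W * (8 * 2 ^ ((W + 3) * k)) := by
      rw [show (W + 3) * (k + 1) = W + (3 + (W + 3) * k) by ring, pow_add, pow_add]
      norm_num
    rw [h2]
    have h3 := Nat.one_le_two_pow (n := (W + 3) * k)
    have h4 := Nat.one_le_two_pow (n := W)
    generalize 2 ^ ((W + 3) * k) = M at *
    calc _ ≤ 2 ^ W * (22 * M + 22 * M + 1 + 1) + 2 ^ W * 1 := by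
          have := Nat.mul_le_mul_right (22 * M + 22 * M + 1 + 1) h1
          omega
      _ = 2 ^ W * (44 * M + 3) := by ring
      _ ≤ 2 ^ W * (22 * (8 * M)) := Nat.mul_le_mul_left _ (by omega)
      _ = _ := by ring

/-! ### Circuits as constraint systems -/

namespace Circuit

variable {n m : ℕ} (c : Circuit n m)

/-- The node obtained from `i` by following COPY gates backwards. -/
def copyRoot (c : Circuit n m) (i : ℕ) : ℕ :=
  match _h : c.nodeAt i with
  | .gcopy j => c.copyRoot j
  | _ => i
termination_by i
decreasing_by exact c.preds_lt (by simp [_h, CNode.preds])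

theorem copyRoot_of_copy {i j : ℕ} (h : c.nodeAt i = .gcopy j) :
    c.copyRoot i = c.copyRoot j := by
  rw [copyRoot]
  split <;> simp_all

theorem copyRoot_of_not_copy {i : ℕ} (h : ∀ j, c.nodeAt i ≠ .gcopy j) : c.copyRoot i = i := by
  rw [copyRoot]
  split <;> simp_all

theorem copyRoot_of_isGate {i : ℕ} (h : (c.nodeAt i).isGate = true) : c.copyRoot i = i :=
  c.copyRoot_of_not_copy fun j hj => by simp [hj, CNode.isGate] at h

theorem evalAux_copyRoot (x : Fin n → Bool) (y : Fin m → Bool) (i : ℕ) :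
    c.evalAux x y (c.copyRoot i) = c.evalAux x y i := by
  induction i using Nat.strong_induction_on with
  | _ i ih =>
    by_cases h : ∃ j, c.nodeAt i = .gcopy j
    · obtain ⟨j, hj⟩ := h
      rw [c.copyRoot_of_copy hj, ih j (c.preds_lt (by simp [hj, CNode.preds])),
        c.evalAux_eq x y i, hj, CNode.value]
    · rw [c.copyRoot_of_not_copy (not_exists.1 h)]

/-- The value `b` of node `i` agrees with the actual input or constant labelling `i`, if any. -/
def InputOk (x : Fin n → Bool) (i : ℕ) (b : Bool) : Prop :=
  (∀ a, c.nodeAt i = .actual a → b = x a) ∧ ∀ b', c.nodeAt i = .const b' → b = b'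

/-- The actual inputs labelling node `i`. -/
def inputVars (i : ℕ) : List (Fin n) :=
  match c.nodeAt i with
  | .actual a => [a]
  | _ => []

theorem length_inputVars_le (i : ℕ) : (c.inputVars i).length ≤ 1 := by
  unfold inputVars
  split <;> simp

variable {c} in
theorem InputOk.congr {x x' : Fin n → Bool} {i : ℕ} {b : Bool}
    (hx : ∀ a ∈ c.inputVars i, x a = x' a) (h : c.InputOk x i b) : c.InputOk x' i b := by
  refine ⟨fun a ha => ?_, h.2⟩
  rw [h.1 a ha]
  exact hx a (by simp [inputVars, ha])

/-- The constraint imposed by the gate `i` on a valuation of the non-COPY nodes. -/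
def GateOk (i : ℕ) (x : Fin n → Bool) (z : ℕ → Bool) : Prop :=
  z i = (c.nodeAt i).value x (fun _ => false) (z ∘ c.copyRoot) ∧
    ∀ j ∈ (c.nodeAt i).preds, c.InputOk x (c.copyRoot j) (z (c.copyRoot j))

/-- The non-COPY nodes on which the constraint of gate `i` depends. -/
def scope (i : ℕ) : Finset ℕ :=
  insert i ((c.nodeAt i).preds.map c.copyRoot).toFinset

theorem card_scope_le (i : ℕ) : (c.scope i).card ≤ 3 := by
  refine (Finset.card_insert_le _ _).trans (Nat.succ_le_succ ?_)
  refine (List.toFinset_card_le _).trans ?_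
  rw [List.length_map]
  exact (c.nodeAt i).length_preds_le

theorem gateOk_congr {i : ℕ} {x : Fin n → Bool} {z z' : ℕ → Bool}
    (hz : ∀ v ∈ c.scope i, z v = z' v) (h : c.GateOk i x z) : c.GateOk i x z' := by
  have hpred : ∀ j ∈ (c.nodeAt i).preds, z (c.copyRoot j) = z' (c.copyRoot j) := fun j hj =>
    hz _ (by simp only [scope, Finset.mem_insert, List.mem_toFinset, List.mem_map]; grind)
  refine ⟨?_, fun j hj => by rw [← hpred j hj]; exact h.2 j hj⟩
  rw [← hz i (by simp [scope]), h.1]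
  exact CNode.value_congr hpred

theorem exists_isGate_imp_gateOk_dependsOn (i : ℕ) : ∃ V : List (Fin n), V.length ≤ 2 ∧
    ∀ x x' z, (∀ a ∈ V, x a = x' a) → ((c.nodeAt i).isGate = true → c.GateOk i x z) →
      (c.nodeAt i).isGate = true → c.GateOk i x' z := by
  refine ⟨(c.nodeAt i).preds.flatMap fun j => c.inputVars (c.copyRoot j), ?_, ?_⟩
  · rw [List.length_flatMap]
    have := List.sum_le_card_nsmul
      ((c.nodeAt i).preds.map fun j => (c.inputVars (c.copyRoot j)).length) 1 (by
        simp only [List.mem_map]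
        rintro _ ⟨j, -, rfl⟩
        exact c.length_inputVars_le _)
    have h2 := (c.nodeAt i).length_preds_le
    simp only [List.length_map, smul_eq_mul, mul_one] at this
    omega
  · intro x x' z hx h hi
    obtain ⟨h1, h2⟩ := h hi
    refine ⟨h1.trans (CNode.value_of_isWide (CNode.isWide_of_isGate hi)), fun j hj => ?_⟩
    exact (h2 j hj).congr fun a ha => hx a (List.mem_flatMap.2 ⟨j, hj, ha⟩)

theorem inputOk_evalAux (x : Fin n → Bool) (y : Fin m → Bool) (i : ℕ) :
    c.InputOk x i (c.evalAux x y i) := by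
  constructor <;> intro a h <;> rw [c.evalAux_eq, h, CNode.value]

theorem gateOk_evalAux {i : ℕ} (hi : (c.nodeAt i).isGate = true) (x : Fin n → Bool)
    (y : Fin m → Bool) : c.GateOk i x (c.evalAux x y) := by
  refine ⟨?_, fun j _ => c.inputOk_evalAux x y _⟩
  rw [c.evalAux_eq x y i, show c.evalAux x y ∘ c.copyRoot = c.evalAux x y from
    funext (c.evalAux_copyRoot x y)]
  exact CNode.value_of_isWide (CNode.isWide_of_isGate hi)

theorem eq_of_guess {i j : ℕ} {g : Fin m} (hi : c.nodeAt i = .guess g)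
    (hj : c.nodeAt j = .guess g) : i = j := by
  have lt : ∀ {i}, c.nodeAt i = .guess g → i < c.N := fun {i} h => by
    by_contra hn
    simp [nodeAt, hn] at h
  have hi' := lt hi
  have hj' := lt hj
  rw [c.nodeAt_of_lt hi'] at hi
  rw [c.nodeAt_of_lt hj'] at hj
  have := Finset.card_le_one.1 (c.guessOnce g) ⟨i, hi'⟩ (by simpa using hi) ⟨j, hj'⟩
    (by simpa using hj)
  simpa using this

open Classical in
theorem exists_evalAux_eq {x : Fin n → Bool} {z : ℕ → Bool}
    (hz : ∀ i, (c.nodeAt i).isGate = true → c.GateOk i x z) :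
    ∃ y : Fin m → Bool, ∀ i, c.InputOk x (c.copyRoot i) (z (c.copyRoot i)) →
      c.evalAux x y i = z (c.copyRoot i) := by
  refine ⟨fun g => decide (∃ i, c.nodeAt i = .guess g ∧ z i = true), fun i => ?_⟩
  induction i using Nat.strong_induction_on with
  | _ i ih =>
    intro hi
    by_cases hg : (c.nodeAt i).isGate = true
    · obtain ⟨h1, h2⟩ := hz i hg
      rw [c.copyRoot_of_isGate hg, h1, c.evalAux_eq,
        CNode.value_of_isWide (CNode.isWide_of_isGate hg)]
      exact CNode.value_congr fun j hj => ih j (c.preds_lt hj) (h2 j hj)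
    · rw [c.evalAux_eq]
      cases h : c.nodeAt i with
      | gcopy j =>
        rw [c.copyRoot_of_copy h] at hi ⊢
        exact ih j (c.preds_lt (by simp [h, CNode.preds])) hi
      | guess g =>
        have hr : c.copyRoot i = i := c.copyRoot_of_not_copy (by simp [h])
        rw [hr, CNode.value]
        have : (∃ j, c.nodeAt j = .guess g ∧ z j = true) ↔ z i = true :=
          ⟨fun ⟨j, hj, hzj⟩ => c.eq_of_guess h hj ▸ hzj, fun hzi => ⟨i, h, hzi⟩⟩
        simp [this]
      | actual a =>
        have hr : c.copyRoot i = i := c.copyRoot_of_not_copy (by simp [h])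
        rw [hr] at hi ⊢
        exact (hi.1 a h).symm
      | const b =>
        have hr : c.copyRoot i = i := c.copyRoot_of_not_copy (by simp [h])
        rw [hr] at hi ⊢
        exact (hi.2 b h).symm
      | _ => simp [h, CNode.isGate] at hg

theorem exists_eval_iff (x : Fin n → Bool) :
    (∃ y, c.eval x y = true) ↔ c.InputOk x (c.copyRoot c.output) true ∧
      ∃ z : ℕ → Bool, z (c.copyRoot c.output) = true ∧
        ∀ i, (c.nodeAt i).isGate = true → c.GateOk i x z := by
  constructor
  · rintro ⟨y, hy⟩
    have h : c.evalAux x y (c.copyRoot c.output) = true := (c.evalAux_copyRoot x y _).trans hy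
    refine ⟨?_, c.evalAux x y, h, fun i hi => c.gateOk_evalAux hi x y⟩
    rw [← h]
    exact c.inputOk_evalAux x y _
  · rintro ⟨h, z, hz, hs⟩
    obtain ⟨y, hy⟩ := c.exists_evalAux_eq hs
    exact ⟨y, (hy c.output (by rwa [hz])).trans hz⟩

end Circuit

/-! ### Separators from layerings -/

namespace Circuit

variable {n m : ℕ} (c : Circuit n m)

/-- A layering of the circuit, extended to all natural numbers. -/
def layer (ℓ : Fin c.N → ℕ) (i : ℕ) : ℕ := if h : i < c.N then ℓ ⟨i, h⟩ else 0

variable {c} {ℓ : Fin c.N → ℕ}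

theorem lt_of_mem_preds {i j : ℕ} (hj : j ∈ (c.nodeAt i).preds) : i < c.N := by
  by_contra h
  simp [nodeAt, h, CNode.preds] at hj

theorem lt_of_isWide {i : ℕ} (hi : (c.nodeAt i).isWide = true) : i < c.N := by
  by_contra h
  simp [nodeAt, h, CNode.isWide] at hi

theorem IsLayering.layer_add_one (hℓ : c.IsLayering ℓ) {i j : ℕ}
    (hj : j ∈ (c.nodeAt i).preds) : c.layer ℓ j + 1 = c.layer ℓ i := by
  have hi := lt_of_mem_preds hj
  have hjN := (c.preds_lt hj).trans hi
  rw [layer, layer, dif_pos hi, dif_pos hjN]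
  rw [c.nodeAt_of_lt hi] at hj
  exact hℓ ⟨i, hi⟩ j hj hjN

theorem IsLayering.layer_copyRoot_le (hℓ : c.IsLayering ℓ) (i : ℕ) :
    c.layer ℓ (c.copyRoot i) ≤ c.layer ℓ i := by
  induction i using Nat.strong_induction_on with
  | _ i ih =>
    by_cases h : ∃ j, c.nodeAt i = .gcopy j
    · obtain ⟨j, hj⟩ := h
      have hp : j ∈ (c.nodeAt i).preds := by simp [hj, CNode.preds]
      rw [c.copyRoot_of_copy hj]
      have := hℓ.layer_add_one hp
      have := ih j (c.preds_lt hp)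
      omega
    · rw [c.copyRoot_of_not_copy (not_exists.1 h)]

theorem IsLayering.exists_isWide_copyRoot_eq (hℓ : c.IsLayering ℓ) {i t : ℕ}
    (h1 : c.layer ℓ (c.copyRoot i) < t) (h2 : t ≤ c.layer ℓ i) :
    ∃ k, c.layer ℓ k = t ∧ (c.nodeAt k).isWide = true ∧ c.copyRoot k = c.copyRoot i := by
  induction i using Nat.strong_induction_on with
  | _ i ih =>
    by_cases h : ∃ j, c.nodeAt i = .gcopy j
    · obtain ⟨j, hj⟩ := h
      have hp : j ∈ (c.nodeAt i).preds := by simp [hj, CNode.preds]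
      rcases h2.eq_or_lt with rfl | h2
      · exact ⟨i, rfl, by simp [hj, CNode.isWide], rfl⟩
      have := hℓ.layer_add_one hp
      rw [c.copyRoot_of_copy hj] at h1 ⊢
      exact ih j (c.preds_lt hp) h1 (by omega)
    · rw [c.copyRoot_of_not_copy (not_exists.1 h)] at h1
      omega

theorem IsLayering.layer_le_of_mem_scope (hℓ : c.IsLayering ℓ) {i v : ℕ} (hv : v ∈ c.scope i) :
    c.layer ℓ v ≤ c.layer ℓ i := by
  simp only [scope, Finset.mem_insert, List.mem_toFinset, List.mem_map] at hv
  rcases hv with rfl | ⟨j, hj, rfl⟩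
  · exact le_rfl
  · have := hℓ.layer_add_one hj
    have := hℓ.layer_copyRoot_le j
    omega

theorem HasWidth.exists_gates_hasSeparators {w : ℕ} (hw : c.HasWidth w) :
    ∃ L : List ℕ, L.length = c.size ∧ (∀ i, i ∈ L ↔ (c.nodeAt i).isGate = true) ∧
      HasSeparators c.scope (4 * w) L := by
  classical
  obtain ⟨ℓ, hℓ, hw⟩ := hw
  let G : Finset ℕ := (Finset.univ.filter fun i : Fin c.N => (c.node i).isGate = true).map
    Fin.valEmbedding
  have hG : ∀ i, i ∈ G ↔ (c.nodeAt i).isGate = true := by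
    intro i
    simp only [G, Finset.mem_map, Finset.mem_filter, Finset.mem_univ, true_and,
      Fin.valEmbedding_apply]
    constructor
    · rintro ⟨k, hk, rfl⟩
      rwa [c.nodeAt_of_lt k.2]
    · intro hi
      have hlt := lt_of_isWide (CNode.isWide_of_isGate hi)
      exact ⟨⟨i, hlt⟩, by rwa [c.nodeAt_of_lt hlt] at hi, rfl⟩
  let r : ℕ → ℕ → Prop := fun i j => c.layer ℓ i ≤ c.layer ℓ j
  have : Std.Total r := ⟨fun i j => le_total _ _⟩
  have : IsTrans ℕ r := ⟨fun i j k => le_trans⟩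
  have hmem : ∀ i, i ∈ G.toList.insertionSort r ↔ (c.nodeAt i).isGate = true := fun i => by
    rw [(List.perm_insertionSort r _).mem_iff, Finset.mem_toList, hG]
  refine ⟨G.toList.insertionSort r, ?_, hmem, fun A B hAB => ?_⟩
  · rw [List.length_insertionSort, Finset.length_toList, Finset.card_map, size]
  have hsorted := List.pairwise_insertionSort r G.toList
  have hB : ∀ i ∈ B, (c.nodeAt i).isGate = true := fun i hi => (hmem i).1 (by simp [hAB, hi])
  have hA : ∀ i ∈ A, (c.nodeAt i).isGate = true := fun i hi => (hmem i).1 (by simp [hAB, hi])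
  rw [hAB] at hsorted
  obtain ⟨-, hsB, hsAB⟩ := List.pairwise_append.1 hsorted
  cases B with
  | nil => exact ⟨∅, by simp, by simp⟩
  | cons b B =>
    set t := c.layer ℓ b with ht
    have hBt : ∀ j ∈ b :: B, t ≤ c.layer ℓ j := by
      intro j hj
      rcases List.mem_cons.1 hj with rfl | hj
      · exact le_rfl
      · exact (List.pairwise_cons.1 hsB).1 j hj
    have hAt : ∀ i ∈ A, c.layer ℓ i ≤ t := fun i hi => hsAB i hi b (by simp)
    let Wt : Finset ℕ := (Finset.univ.filter fun i : Fin c.N =>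
      ℓ i = t ∧ (c.node i).isWide = true).map Fin.valEmbedding
    have hWt : ∀ i, c.layer ℓ i = t → (c.nodeAt i).isWide = true → i ∈ Wt := by
      intro i hi hwide
      have hlt := lt_of_isWide hwide
      rw [c.nodeAt_of_lt hlt] at hwide
      rw [layer, dif_pos hlt] at hi
      exact Finset.mem_map.2 ⟨⟨i, hlt⟩, by simp [hi, hwide], rfl⟩
    have hWcard : Wt.card ≤ w := (Finset.card_map _).trans_le (hw t)
    refine ⟨Wt.image c.copyRoot ∪ Wt.biUnion c.scope, ?_, fun i hi j hj v hv => ?_⟩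
    · have h1 := (Finset.card_image_le (s := Wt) (f := c.copyRoot)).trans hWcard
      have h2 := Finset.card_biUnion_le_card_mul Wt c.scope 3 fun i _ => c.card_scope_le i
      have h3 := Finset.card_union_le (Wt.image c.copyRoot) (Wt.biUnion c.scope)
      omega
    obtain ⟨hvi, hvj⟩ := Finset.mem_inter.1 hv
    rw [Finset.mem_union]
    by_cases hit : c.layer ℓ i = t
    · exact Or.inr (Finset.mem_biUnion.2
        ⟨i, hWt i hit (CNode.isWide_of_isGate (hA i hi)), hvi⟩)
    by_cases hjt : c.layer ℓ j = t
    · exact Or.inr (Finset.mem_biUnion.2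
        ⟨j, hWt j hjt (CNode.isWide_of_isGate (hB j hj)), hvj⟩)
    have hit' := lt_of_le_of_ne (hAt i hi) hit
    have hjt' := lt_of_le_of_ne (hBt j hj) (Ne.symm hjt)
    have hvt := (hℓ.layer_le_of_mem_scope hvi).trans_lt hit'
    simp only [scope, Finset.mem_insert, List.mem_toFinset, List.mem_map] at hvj
    rcases hvj with rfl | ⟨p, hp, rfl⟩
    · omega
    · have := hℓ.layer_add_one hp
      obtain ⟨k, hk, hkw, hkr⟩ := hℓ.exists_isWide_copyRoot_eq hvt (by omega)
      exact Or.inl (Finset.mem_image.2 ⟨k, hWt k hk hkw, hkr⟩)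

/-- Nondeterminism can be removed from a circuit of width `w` with at most `2 ^ k` gates. -/
theorem Computes.exists_deterministic {f : (Fin n → Bool) → Bool} {w k : ℕ}
    (hf : c.Computes f) (hw : c.HasWidth w) (hk : c.size ≤ 2 ^ k) :
    ∃ D : Circuit n 0, D.Computes f ∧ D.size ≤ 2 ^ (6 + (4 * w + 3) * k) ∧
      D.HasWidth (2 * k + 6) := by
  obtain ⟨L, hLlen, hLmem, hsep⟩ := hw.exists_gates_hasSeparators
  refine RegComputable.exists_circuit (by omega) ?_
  have h1 : RegComputable (fun x => c.InputOk x (c.copyRoot c.output) true) 3 8 := by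
    have hlen := c.length_inputVars_le (c.copyRoot c.output)
    refine (RegComputable.of_dependsOn (c.inputVars (c.copyRoot c.output))
      fun x x' hx h => h.congr hx).mono (by omega) ?_
    have := Nat.pow_le_pow_right two_pos hlen
    omega
  have h2 := regComputable_solvable (scope := c.scope)
    (P := fun i x z => (c.nodeAt i).isGate = true → c.GateOk i x z)
    (fun i x z z' hz h hi => c.gateOk_congr hz (h hi))
    c.exists_isGate_imp_gateOk_dependsOn k L (hLlen.trans_le hk) hsep
    {c.copyRoot c.output} fun _ => true
  refine ((h1.and h2 (by omega)).mono (by omega) ?_).congr fun x => ?_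
  · rw [pow_add]
    have := Nat.one_le_two_pow (n := (4 * w + 3) * k)
    omega
  · rw [hf x, c.exists_eval_iff x]
    refine and_congr_right fun _ => exists_congr fun z => ?_
    simp only [Finset.mem_singleton, forall_eq, hLmem]
    exact and_congr_right fun _ => ⟨fun h i hi => h i hi hi, fun h i _ hi => h i hi⟩

end Circuit

/-- circuit-level content of `L/quasipoly ⊇ NL/poly`.
For all constants `a, b > 0` there are `c > 0` and a threshold `n₀` such that
for all `n ≥ n₀`: every nondeterministic circuit with `n` actual inputs of size
at most `n^a` and width at most `b·log₂ n` can be converted to a deterministic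
circuit computing the same Boolean function, of size at most `2^(c·(log₂ n)²)`
and width at most `c·log₂ n`. -/
theorem poly_size_log_width_ndc_to_dc :
    ∀ a b : ℝ, 0 < a → 0 < b →
      ∃ c : ℝ, 0 < c ∧ ∃ n₀ : ℕ,
        ∀ n : ℕ, n₀ ≤ n →
          ∀ (m : ℕ) (C : Circuit n m) (f : (Fin n → Bool) → Bool) (w : ℕ),
            C.Computes f → (C.size : ℝ) ≤ (n : ℝ) ^ a → C.HasWidth w →
            (w : ℝ) ≤ b * Real.logb 2 (n : ℝ) →
            ∃ D : Circuit n 0, D.Computes f ∧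
              (D.size : ℝ) ≤ 2 ^ (c * (Real.logb 2 (n : ℝ)) ^ 2) ∧
              ∃ w' : ℕ, D.HasWidth w' ∧ (w' : ℝ) ≤ c * Real.logb 2 (n : ℝ) := by
  intro a b ha hb
  refine ⟨6 + (4 * b + 3) * (a + 1) + (2 * a + 8), by positivity, 2, ?_⟩
  intro n hn m C f w hf hsize hwidth hw
  have hn' : (2 : ℝ) ≤ n := by exact_mod_cast hn
  set l := Real.logb 2 (n : ℝ) with hl
  have hl1 : 1 ≤ l := by
    rw [hl, Real.le_logb_iff_rpow_le one_lt_two (by linarith)]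
    simpa using hn'
  have hk : (⌈a * l⌉₊ : ℝ) ≤ (a + 1) * l := by
    have := Nat.ceil_lt_add_one (a := a * l) (by positivity)
    linarith
  have hpow : (n : ℝ) ^ a = 2 ^ (a * l) := by
    rw [mul_comm, Real.rpow_mul two_pos.le, hl,
      Real.rpow_logb two_pos (by norm_num) (by linarith)]
  have hsize' : C.size ≤ 2 ^ ⌈a * l⌉₊ := by
    have : (C.size : ℝ) ≤ (2 : ℝ) ^ (⌈a * l⌉₊ : ℝ) :=
      (hsize.trans_eq hpow).trans
        (Real.rpow_le_rpow_of_exponent_le one_le_two (Nat.le_ceil _))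
    rw [Real.rpow_natCast] at this
    exact_mod_cast this
  obtain ⟨D, hD, hDsize, hDwidth⟩ := hf.exists_deterministic hwidth hsize'
  refine ⟨D, hD, ?_, _, hDwidth, ?_⟩
  · have h1 : (D.size : ℝ) ≤ (2 : ℝ) ^ ((6 + (4 * w + 3) * ⌈a * l⌉₊ : ℕ) : ℝ) := by
      rw [Real.rpow_natCast]
      exact_mod_cast hDsize
    refine h1.trans (Real.rpow_le_rpow_of_exponent_le one_le_two ?_)
    push_cast
    have h2 : (4 * (w : ℝ) + 3) ≤ (4 * b + 3) * l := by nlinarith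
    have h3 : (4 * (w : ℝ) + 3) * ⌈a * l⌉₊ ≤ ((4 * b + 3) * l) * ((a + 1) * l) :=
      mul_le_mul h2 hk (by positivity) (by positivity)
    have h4 : 1 ≤ l ^ 2 := one_le_pow₀ hl1
    nlinarith [mul_pos ha (lt_of_lt_of_le one_pos h4)]
  · push_cast
    have : 0 ≤ (6 + (4 * b + 3) * (a + 1)) * l := by positivity
    nlinarith
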